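/- arXiv:2003.03311 — 5 statements merged into one kernel-verified Lean document; each statement's English description precedes it below -/
import Mathlib

section
/- Let p ∈ [0, 1], let α, β > 0, and let G be a (p, β)-sparse graph on n vertices. Assume A ⊆ V(G) is a subset such that deg_G(a) ≥ |A|·p + α·n·p for all a ∈ A. Then e_G(A, V(G) \ A) ≥ (α·n·p − β)·|A|. In particular, if A is nonempty, then there exists a vertex a ∈ A such that deg_G(a, V(G) \ A) ≥ α·n·p − β. -/
open Finset
open scoped Classical

/-- The number of ordered pairs `(x, y) ∈ X × Y` that form an edge of `G`. -/
noncomputable def eBtw {V : Type} (G : SimpleGraph V) (X Y : Finset V) : ℕ :=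
  ((X ×ˢ Y).filter fun e => G.Adj e.1 e.2).card

/-- The number of neighbours of `v` in `S`. -/
noncomputable def degIn {V : Type} (G : SimpleGraph V) (v : V) (S : Finset V) : ℕ :=
  (S.filter fun w => G.Adj v w).card

/-- `G` is `(p, β)`-sparse. -/
def IsSparse {V : Type} (G : SimpleGraph V) (p β : ℝ) : Prop :=
  ∀ X Y : Finset V,
    (eBtw G X Y : ℝ) ≤ p * (X.card : ℝ) * (Y.card : ℝ) +
      β * Real.sqrt ((X.card : ℝ) * (Y.card : ℝ))

/-- `G` is a `q`-expander: every partition `V = X ∪ Xᶜ` has at least `q|X||Xᶜ|` crossing edges. -/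
def IsExpander {V : Type} [Fintype V] [DecidableEq V] (G : SimpleGraph V) (q : ℝ) : Prop :=
  ∀ X : Finset V, q * (X.card : ℝ) * (Xᶜ.card : ℝ) ≤ (eBtw G X Xᶜ : ℝ)

/-- The induced subgraph `G[S]` is a `q`-expander. -/
def IsExpanderOn {V : Type} [DecidableEq V] (G : SimpleGraph V) (q : ℝ) (S : Finset V) : Prop :=
  ∀ X ⊆ S, q * (X.card : ℝ) * (((S \ X).card : ℝ)) ≤ (eBtw G X (S \ X) : ℝ)

/-- The vertex set of `G` can be covered by `k` cycles. -/
def CycleCover {V : Type} (G : SimpleGraph V) (k : ℕ) : Prop :=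
  ∃ c : Fin k → Σ v : V, G.Walk v v,
    (∀ i, (c i).2.IsCycle) ∧ ∀ v : V, ∃ i, v ∈ (c i).2.support

/-- If every vertex of `A` has degree at least `|A|p + αnp`, then at least `(αnp − β)|A|` edges
leave `A`; in particular some vertex of a nonempty `A` has at least `αnp − β` neighbours
outside of `A`. -/
theorem stmt3 {n : ℕ} (p α β : ℝ) (hp0 : 0 ≤ p) (hp1 : p ≤ 1) (hα : 0 < α) (hβ : 0 < β)
    (G : SimpleGraph (Fin n)) (hG : IsSparse G p β) (A : Finset (Fin n))
    (hdeg : ∀ a ∈ A, (A.card : ℝ) * p + α * (n : ℝ) * p ≤ (degIn G a Finset.univ : ℝ)) :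
    (α * (n : ℝ) * p - β) * (A.card : ℝ) ≤ (eBtw G A Aᶜ : ℝ) ∧
    (A.Nonempty → ∃ a ∈ A, α * (n : ℝ) * p - β ≤ (degIn G a Aᶜ : ℝ)) := by
  have key : ∀ X Y : Finset (Fin n), eBtw G X Y = ∑ a ∈ X, degIn G a Y := by
    intro X Y
    simp only [eBtw, degIn, Finset.card_filter]
    exact Finset.sum_product _ _ _
  have hsplit : ∀ a, degIn G a Finset.univ = degIn G a A + degIn G a Aᶜ := by
    intro a
    simp only [degIn, Finset.card_filter]
    exact (Finset.sum_add_sum_compl A _).symm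
  have h1 : (α * (n : ℝ) * p - β) * (A.card : ℝ) ≤ (eBtw G A Aᶜ : ℝ) := by
    have hA := hG A A
    rw [Real.sqrt_mul_self (Nat.cast_nonneg _)] at hA
    have hs := Finset.sum_le_sum hdeg
    have he : ∑ a ∈ A, (degIn G a Finset.univ : ℝ) = (eBtw G A A : ℝ) + (eBtw G A Aᶜ : ℝ) := by
      rw [key, key]
      push_cast
      rw [← Finset.sum_add_distrib]
      refine Finset.sum_congr rfl fun a _ => ?_
      rw [hsplit]
      push_cast
      rfl
    rw [he, Finset.sum_const, nsmul_eq_mul] at hs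
    nlinarith
  refine ⟨h1, fun hne => ?_⟩
  rw [key] at h1
  push_cast at h1
  apply Finset.exists_le_of_sum_le hne
  rw [Finset.sum_const, nsmul_eq_mul]
  linarith
end

section
/- Let q > 0. Every q-expander G contains a spanning bipartite (q/2)-expander as a subgraph. -/
open Finset
open scoped Classical

/-- Twice the cut size as a sum over ordered pairs. -/
lemma two_eBtw {n : ℕ} (G : SimpleGraph (Fin n)) (X : Finset (Fin n)) :
    2 * eBtw G X Xᶜ = ∑ u, ∑ v, if G.Adj u v ∧ (u ∈ X ↔ v ∉ X) then 1 else 0 := by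
  have h1 : eBtw G X Xᶜ = ∑ u, ∑ v, if G.Adj u v ∧ u ∈ X ∧ v ∉ X then 1 else 0 := by
    rw [← Finset.sum_product', ← Finset.card_filter]
    unfold eBtw
    congr 1
    ext ⟨a, b⟩
    simp
    tauto
  have h2 : eBtw G X Xᶜ = ∑ u, ∑ v, if G.Adj v u ∧ v ∈ X ∧ u ∉ X then 1 else 0 := by
    rw [h1, Finset.sum_comm]
  rw [two_mul]
  nth_rewrite 1 [h1]
  rw [h2, ← Finset.sum_add_distrib]
  refine Finset.sum_congr rfl fun u _ => ?_
  rw [← Finset.sum_add_distrib]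
  refine Finset.sum_congr rfl fun v _ => ?_
  have := G.adj_comm u v
  by_cases h : G.Adj u v <;> by_cases hu : u ∈ X <;> by_cases hv : v ∈ X <;> simp_all

/-- Every `q`-expander contains a spanning bipartite `(q/2)`-expander as a subgraph. -/
theorem stmt4 {n : ℕ} (q : ℝ) (hq : 0 < q) (G : SimpleGraph (Fin n)) (hG : IsExpander G q) :
    ∃ H : SimpleGraph (Fin n), H ≤ G ∧
      (∃ A : Set (Fin n), ∀ u v, H.Adj u v → (u ∈ A ↔ v ∉ A)) ∧
      IsExpander H (q / 2) := by
  obtain ⟨A, hA⟩ := Finite.exists_max (fun A : Finset (Fin n) => 2 * eBtw G A Aᶜ)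
  let H : SimpleGraph (Fin n) :=
    { Adj := fun u v => G.Adj u v ∧ (u ∈ A ↔ v ∉ A)
      symm := ⟨fun u v h => ⟨h.1.symm, by tauto⟩⟩
      loopless := ⟨fun u h => G.loopless.irrefl u h.1⟩ }
  refine ⟨H, fun u v h => h.1, ⟨(A : Set (Fin n)), fun u v h => by simpa using h.2⟩, fun X => ?_⟩
  have key : 2 * eBtw G (symmDiff A X) (symmDiff A X)ᶜ + 2 * (2 * eBtw H X Xᶜ)
      = 2 * eBtw G A Aᶜ + 2 * eBtw G X Xᶜ := by
    rw [two_eBtw, two_eBtw, two_eBtw, two_eBtw, Finset.mul_sum, ← Finset.sum_add_distrib,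
      ← Finset.sum_add_distrib]
    refine Finset.sum_congr rfl fun u _ => ?_
    rw [Finset.mul_sum, ← Finset.sum_add_distrib, ← Finset.sum_add_distrib]
    refine Finset.sum_congr rfl fun v _ => ?_
    have hH : H.Adj u v ↔ G.Adj u v ∧ (u ∈ A ↔ v ∉ A) := Iff.rfl
    simp only [hH, Finset.mem_symmDiff]
    by_cases h : G.Adj u v <;> by_cases hu : u ∈ X <;> by_cases hv : v ∈ X <;>
      by_cases hu' : u ∈ A <;> by_cases hv' : v ∈ A <;> simp [h, hu, hv, hu', hv']
  have hm := hA (symmDiff A X)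
  have hle : eBtw G X Xᶜ ≤ 2 * eBtw H X Xᶜ := by
    omega
  have hle' : (eBtw G X Xᶜ : ℝ) ≤ 2 * (eBtw H X Xᶜ : ℝ) := by exact_mod_cast hle
  have := hG X
  linarith
end

section
/- For all c, α, ξ ∈ (0, 1), there exist positive γ = γ(α, ξ, c) and η = η(α, ξ, c) such that the following holds for all sufficiently large n. Let p ∈ (0, 1) and β ≤ η·n·p, and let G be a (p, β)-sparse graph on n vertices with minimum degree at least (c + α)·n·p. Then there exists a partition V(G) = V₁ ∪ ⋯ ∪ V_ℓ into 1 ≤ ℓ < 1/c parts such that, for every i ∈ [ℓ]: (i) the induced subgraph G[V_i] is a γp-expander, (ii) δ(G[V_i]) ≥ c²·n·p, and (iii) δ_ξ(G[V_i]) ≥ (c + α − ξ)·n·p. -/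
open Finset
open scoped Classical

/-- Adjacency indicator. -/
noncomputable def adjI {n : ℕ} (G : SimpleGraph (Fin n)) (u w : Fin n) : ℝ :=
  if G.Adj u w then 1 else 0

/-- Number of ordered pairs of adjacent vertices of different colours. -/
noncomputable def crossI {n k : ℕ} (G : SimpleGraph (Fin n)) (f : Fin n → Fin k) : ℝ :=
  ∑ u, ∑ w, if f u ≠ f w then adjI G u w else 0

/-- Colour class. -/
noncomputable def cls {n k : ℕ} (f : Fin n → Fin k) (i : Fin k) : Finset (Fin n) :=
  Finset.univ.filter fun u => f u = i

lemma adjI_nonneg {n : ℕ} (G : SimpleGraph (Fin n)) (u w : Fin n) : 0 ≤ adjI G u w := by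
  unfold adjI; split_ifs <;> norm_num

lemma adjI_symm {n : ℕ} (G : SimpleGraph (Fin n)) (u w : Fin n) : adjI G u w = adjI G w u := by
  unfold adjI; simp [G.adj_comm]

lemma adjI_self {n : ℕ} (G : SimpleGraph (Fin n)) (u : Fin n) : adjI G u u = 0 := by
  unfold adjI; simp

lemma degIn_eq {n : ℕ} (G : SimpleGraph (Fin n)) (v : Fin n) (S : Finset (Fin n)) :
    (degIn G v S : ℝ) = ∑ w ∈ S, adjI G v w := by
  unfold degIn adjI
  rw [Finset.card_filter]; push_cast; rfl

lemma eBtw_eq {n : ℕ} (G : SimpleGraph (Fin n)) (X Y : Finset (Fin n)) :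
    (eBtw G X Y : ℝ) = ∑ u ∈ X, ∑ w ∈ Y, adjI G u w := by
  unfold eBtw adjI
  rw [Finset.card_filter, Finset.sum_product]; push_cast; rfl

lemma sum_split_vertex {n : ℕ} (a : Fin n → Fin n → ℝ) (hs : ∀ u w, a u w = a w u)
    (v : Fin n) (h0 : a v v = 0) :
    ∑ u, ∑ w, a u w = 2 * ∑ w, a v w
      + ∑ u ∈ Finset.univ.erase v, ∑ w ∈ Finset.univ.erase v, a u w := by
  have h1 : ∀ g : Fin n → ℝ, ∑ u, g u = g v + ∑ u ∈ Finset.univ.erase v, g u := fun g =>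
    (Finset.add_sum_erase _ _ (Finset.mem_univ v)).symm
  rw [h1 (fun u => ∑ w, a u w)]
  have h2 : ∑ u ∈ Finset.univ.erase v, ∑ w, a u w
      = ∑ u ∈ Finset.univ.erase v, a v u
        + ∑ u ∈ Finset.univ.erase v, ∑ w ∈ Finset.univ.erase v, a u w := by
    rw [← Finset.sum_add_distrib]
    refine Finset.sum_congr rfl fun u _ => ?_
    rw [h1 (a u), hs u v]
  have h3 := h1 (a v)
  rw [h2]; linarith

lemma sum_ne_add_cls {n k : ℕ} (G : SimpleGraph (Fin n)) (f : Fin n → Fin k) (v : Fin n)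
    (i : Fin k) :
    (∑ w, if i ≠ f w then adjI G v w else 0) + degIn G v (cls f i) = degIn G v Finset.univ := by
  rw [degIn_eq, degIn_eq, cls, Finset.sum_filter, ← Finset.sum_add_distrib]
  refine Finset.sum_congr rfl fun w _ => ?_
  by_cases h : f w = i
  · simp [h]
  · simp [h, Ne.symm h]

lemma crossI_update {n k : ℕ} (G : SimpleGraph (Fin n)) (f : Fin n → Fin k) (v : Fin n)
    (j : Fin k) :
    crossI G (Function.update f v j) + 2 * degIn G v (cls f j)
      = crossI G f + 2 * degIn G v (cls f (f v)) := by
  have key : ∀ g : Fin n → Fin k, crossI G g = 2 * (∑ w, if g v ≠ g w then adjI G v w else 0)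
      + ∑ u ∈ Finset.univ.erase v, ∑ w ∈ Finset.univ.erase v,
        if g u ≠ g w then adjI G u w else 0 := by
    intro g
    unfold crossI
    refine sum_split_vertex (fun u w => if g u ≠ g w then adjI G u w else 0) ?_ v (by simp)
    intro u w
    simp only [adjI_symm G u w, ne_comm]
  have h1 := sum_ne_add_cls G f v (f v)
  have h2 := sum_ne_add_cls G f v j
  rw [key f, key (Function.update f v j)]
  have h3 : (∑ w, if Function.update f v j v ≠ Function.update f v j w then adjI G v w else 0)
      = ∑ w, if j ≠ f w then adjI G v w else 0 := by
    refine Finset.sum_congr rfl fun w _ => ?_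
    by_cases hw : w = v
    · subst hw; simp [adjI_self]
    · simp [Function.update_of_ne hw]
  have h4 : (∑ u ∈ Finset.univ.erase v, ∑ w ∈ Finset.univ.erase v,
        if Function.update f v j u ≠ Function.update f v j w then adjI G u w else 0)
      = ∑ u ∈ Finset.univ.erase v, ∑ w ∈ Finset.univ.erase v,
        if f u ≠ f w then adjI G u w else 0 := by
    refine Finset.sum_congr rfl fun u hu => Finset.sum_congr rfl fun w hw => ?_
    rw [Function.update_of_ne (Finset.ne_of_mem_erase hu),
      Function.update_of_ne (Finset.ne_of_mem_erase hw)]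
  rw [h3, h4]; linarith

/-- Edges leaving `Y ⊆ cls f i`. -/
lemma leave_le {n k : ℕ} (G : SimpleGraph (Fin n)) (f : Fin n → Fin k) (i : Fin k)
    (Y : Finset (Fin n)) (hY : Y ⊆ cls f i) :
    ∑ v ∈ Y, ((degIn G v Finset.univ : ℝ) - degIn G v (cls f i)) ≤ crossI G f := by
  have h : ∀ v ∈ Y, ((degIn G v Finset.univ : ℝ) - degIn G v (cls f i))
      = ∑ w, if f v ≠ f w then adjI G v w else 0 := by
    intro v hv
    have hvi : f v = i := by simpa [cls] using hY hv
    have := sum_ne_add_cls G f v i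
    rw [hvi]; linarith
  rw [Finset.sum_congr rfl h]
  unfold crossI
  refine Finset.sum_le_sum_of_subset_of_nonneg (Finset.subset_univ _) fun u _ _ => ?_
  refine Finset.sum_nonneg fun w _ => ?_
  split_ifs
  · exact adjI_nonneg G u w
  · exact le_rfl

/-- Splitting a part. -/
lemma crossI_split {n k : ℕ} (G : SimpleGraph (Fin n)) (f : Fin n → Fin k) (i : Fin k)
    (X : Finset (Fin n)) (hX : X ⊆ cls f i) :
    crossI G (fun u => if u ∈ X then Fin.last k else (f u).castSucc)
      ≤ crossI G f + 2 * eBtw G X (cls f i \ X) := by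
  have hE : (eBtw G X (cls f i \ X) : ℝ)
      = ∑ u, ∑ w, if u ∈ X ∧ w ∈ cls f i \ X then adjI G u w else 0 := by
    rw [eBtw_eq, ← Finset.sum_filter_add_sum_filter_not Finset.univ (fun u => u ∈ X)]
    have hz : (∑ u ∈ Finset.univ.filter (fun u => ¬ u ∈ X),
        ∑ w, if u ∈ X ∧ w ∈ cls f i \ X then adjI G u w else 0) = 0 := by
      refine Finset.sum_eq_zero fun u hu => Finset.sum_eq_zero fun w _ => ?_
      have : u ∉ X := by simpa using hu
      simp [this]
    rw [hz, add_zero]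
    have hf : Finset.univ.filter (fun u => u ∈ X) = X := by ext; simp
    rw [hf]
    refine Finset.sum_congr rfl fun u hu => ?_
    simp only [hu, true_and]
    rw [← Finset.sum_filter]
    congr 1
    ext; simp
  have hE' : (eBtw G X (cls f i \ X) : ℝ)
      = ∑ u, ∑ w, if w ∈ X ∧ u ∈ cls f i \ X then adjI G u w else 0 := by
    rw [hE, Finset.sum_comm]
    refine Finset.sum_congr rfl fun u _ => Finset.sum_congr rfl fun w _ => ?_
    rw [adjI_symm]
  have : crossI G f + 2 * (eBtw G X (cls f i \ X) : ℝ)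
      = ∑ u, ∑ w, ((if f u ≠ f w then adjI G u w else 0)
        + ((if u ∈ X ∧ w ∈ cls f i \ X then adjI G u w else 0)
        + (if w ∈ X ∧ u ∈ cls f i \ X then adjI G u w else 0))) := by
    simp only [Finset.sum_add_distrib]
    rw [← hE, ← hE']; unfold crossI; ring
  rw [this]
  unfold crossI
  refine Finset.sum_le_sum fun u _ => Finset.sum_le_sum fun w _ => ?_
  have ha := adjI_nonneg G u w
  have hXi : ∀ x ∈ X, f x = i := fun x hx => by simpa [cls] using hX hx
  by_cases hu : u ∈ X <;> by_cases hw : w ∈ X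
  · simp [hu, hw]; split_ifs <;> linarith
  · have := hXi u hu
    by_cases hwi : f w = i
    · simp [hu, hw, cls, hwi, this]; split_ifs <;> linarith
    · have h2 : ¬ (i = f w) := fun h => hwi h.symm
      simp [hu, hw, cls, hwi, this, h2]; split_ifs <;> linarith
  · have := hXi w hw
    by_cases hwi : f u = i
    · simp [hu, hw, cls, hwi, this]
    · simp [hu, hw, cls, hwi, this]
  · simp [hu, hw, cls]

/-- Dense sets are large. -/
lemma size_of_dense {n : ℕ} (G : SimpleGraph (Fin n)) (p β η d : ℝ) (hp : 0 < p)
    (hβ : β ≤ η * (n : ℝ) * p) (hG : IsSparse G p β) (Y : Finset (Fin n))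
    (hY : 0 < Y.card) (h : d * n * p * Y.card ≤ (eBtw G Y Y : ℝ)) :
    (d - η) * n ≤ Y.card := by
  have h1 := hG Y Y
  have hy : (0 : ℝ) < Y.card := by exact_mod_cast hY
  rw [Real.sqrt_mul_self hy.le] at h1
  have h2 : β * (Y.card : ℝ) ≤ η * n * p * Y.card := mul_le_mul_of_nonneg_right hβ hy.le
  have h3 : ((d - η) * n) * (p * Y.card) ≤ Y.card * (p * Y.card) := by nlinarith
  exact le_of_mul_le_mul_right h3 (by positivity)

lemma eBtw_self_split {n : ℕ} (G : SimpleGraph (Fin n)) (X S : Finset (Fin n)) (h : X ⊆ S) :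
    (eBtw G X X : ℝ) + eBtw G X (S \ X) = ∑ v ∈ X, (degIn G v S : ℝ) := by
  rw [eBtw_eq, eBtw_eq, ← Finset.sum_add_distrib]
  refine Finset.sum_congr rfl fun v _ => ?_
  rw [degIn_eq, add_comm, Finset.sum_sdiff h]

lemma eBtw_swap {n : ℕ} (G : SimpleGraph (Fin n)) (X Y : Finset (Fin n)) :
    (eBtw G X Y : ℝ) = eBtw G Y X := by
  rw [eBtw_eq, eBtw_eq, Finset.sum_comm]
  refine Finset.sum_congr rfl fun u _ => Finset.sum_congr rfl fun w _ => adjI_symm _ _ _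

/-- Boosting: a linear-size set inside a class with few leaving edges is large. -/
lemma size_boost {n k : ℕ} (G : SimpleGraph (Fin n)) (f : Fin n → Fin k) (i : Fin k)
    (c α p β η ε γ : ℝ) (hc : 0 < c) (hp : 0 < p) (hn : 0 < n)
    (hε : 0 ≤ ε) (hε' : ε ≤ c ^ 2 * (α / 8)) (hη : η ≤ α / 8) (hγ : γ ≤ α / 8)
    (hβ : β ≤ η * (n : ℝ) * p) (hG : IsSparse G p β)
    (hdeg : ∀ v, (c + α) * (n : ℝ) * p ≤ (degIn G v Finset.univ : ℝ))
    (hcr : crossI G f ≤ ε * p * n ^ 2)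
    (Y : Finset (Fin n)) (hY : Y ⊆ cls f i) (hYc : c ^ 2 * n ≤ Y.card)
    (hl : (eBtw G Y (cls f i \ Y) : ℝ) ≤ γ * p * Y.card * n) :
    (c + α / 2) * n ≤ Y.card := by
  have hn' : (0 : ℝ) < n := by exact_mod_cast hn
  have hy : (0 : ℝ) < Y.card := lt_of_lt_of_le (by positivity) hYc
  have h1 := eBtw_self_split G Y _ hY
  have h2 := leave_le G f i Y hY
  rw [Finset.sum_sub_distrib] at h2
  have h3 : Y.card * ((c + α) * (n : ℝ) * p) ≤ ∑ v ∈ Y, (degIn G v Finset.univ : ℝ) := by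
    rw [← nsmul_eq_mul]; exact Finset.card_nsmul_le_sum _ _ _ fun v _ => hdeg v
  have h4 : ε * p * n ^ 2 ≤ (α / 8) * n * p * Y.card := by
    have hα : 0 ≤ α / 8 := by
      by_contra hcon
      push Not at hcon
      have : c ^ 2 * (α / 8) < 0 := mul_neg_of_pos_of_neg (by positivity) hcon
      linarith
    calc ε * p * n ^ 2 ≤ (c ^ 2 * (α / 8)) * p * n ^ 2 := by gcongr
      _ = (α / 8) * n * p * (c ^ 2 * n) := by ring
      _ ≤ _ := by gcongr
  have h5 : γ * p * Y.card * n ≤ (α / 8) * p * Y.card * n := by gcongr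
  have h6 := size_of_dense G p β η (c + α - α / 4) hp hβ hG Y (by exact_mod_cast hy)
    (by nlinarith)
  refine le_trans ?_ h6
  refine mul_le_mul_of_nonneg_right ?_ hn'.le
  have : 0 ≤ α := by
    by_contra hcon
    push Not at hcon
    have : c ^ 2 * (α / 8) < 0 := mul_neg_of_pos_of_neg (by positivity) (by linarith)
    linarith
  linarith

/-- Admissible colourings. -/
def Adm {n : ℕ} (G : SimpleGraph (Fin n)) (c γ p : ℝ) (k : ℕ) (f : Fin n → Fin k) : Prop :=
  (∀ i, c * n ≤ (cls f i).card) ∧ crossI G f ≤ 2 * γ * k * p * n ^ 2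

lemma sum_cls_card {n k : ℕ} (f : Fin n → Fin k) : ∑ i, (cls f i).card = n := by
  have := Finset.card_eq_sum_card_fiberwise (s := (Finset.univ : Finset (Fin n)))
    (t := (Finset.univ : Finset (Fin k))) (f := f) (by intro x _; simp)
  simpa [cls] using this.symm

lemma adm_bound {n k : ℕ} (f : Fin n → Fin k) (c : ℝ) (hn : 0 < n)
    (h : ∀ i, c * n ≤ (cls f i).card) : k * c ≤ 1 := by
  have hn' : (0 : ℝ) < n := by exact_mod_cast hn
  have h1 : (k : ℝ) * (c * n) ≤ n := by
    have h2 : ((∑ i, (cls f i).card : ℕ) : ℝ) = n := by rw [sum_cls_card]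
    push_cast at h2
    have h3 := Finset.card_nsmul_le_sum (Finset.univ : Finset (Fin k))
      (fun i => ((cls f i).card : ℝ)) (c * n) (fun i _ => h i)
    rw [nsmul_eq_mul, Finset.card_fin] at h3
    linarith
  have : (k * c) * n ≤ 1 * (n : ℝ) := by linarith
  exact le_of_mul_le_mul_right this hn'

lemma sum_degIn_cls {n k : ℕ} (G : SimpleGraph (Fin n)) (f : Fin n → Fin k) (v : Fin n) :
    ∑ i, (degIn G v (cls f i) : ℝ) = degIn G v Finset.univ := by
  simp only [degIn_eq, cls]
  exact Finset.sum_fiberwise _ _ _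

lemma exists_opt {n : ℕ} (G : SimpleGraph (Fin n)) (c γ p : ℝ) (hn : 0 < n)
    (hc : 0 < c) (hc1 : c < 1) (hγ : 0 < γ) (hp : 0 < p) :
    ∃ k : ℕ, 1 ≤ k ∧ ∃ f : Fin n → Fin k, Adm G c γ p k f ∧
      (∀ g : Fin n → Fin k, Adm G c γ p k g → crossI G f ≤ crossI G g) ∧
      ∀ g : Fin n → Fin (k + 1), ¬ Adm G c γ p (k + 1) g := by
  let Q : ℕ → Prop := fun k => ∃ f : Fin n → Fin k, Adm G c γ p k f
  have hn' : (0 : ℝ) < n := by exact_mod_cast hn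
  have hb : ∀ k, Q k → k ≤ ⌈1 / c⌉₊ := by
    rintro k ⟨f, hf⟩
    have h1 := adm_bound f c hn hf.1
    have h2 : (k : ℝ) ≤ 1 / c := by rw [le_div_iff₀ hc]; exact h1
    exact_mod_cast h2.trans (Nat.le_ceil _)
  have h1 : Q 1 := by
    refine ⟨fun _ => 0, ?_, ?_⟩
    · intro i
      have : cls (fun _ : Fin n => (0 : Fin 1)) i = Finset.univ := by
        ext u; simp [cls, Subsingleton.elim i 0]
      rw [this, Finset.card_fin]; nlinarith
    · have : crossI G (fun _ : Fin n => (0 : Fin 1)) = 0 := by simp [crossI]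
      rw [this]; positivity
  obtain ⟨f0, hf0⟩ : Q (Nat.findGreatest Q ⌈1 / c⌉₊) := Nat.findGreatest_spec (hb 1 h1) h1
  have hk1 : 1 ≤ Nat.findGreatest Q ⌈1 / c⌉₊ := Nat.le_findGreatest (hb 1 h1) h1
  have hmax : ¬ Q (Nat.findGreatest Q ⌈1 / c⌉₊ + 1) := by
    intro h
    have := Nat.le_findGreatest (hb _ h) h
    omega
  generalize Nat.findGreatest Q ⌈1 / c⌉₊ = k at *
  obtain ⟨f, hf, hmin⟩ := Finset.exists_min_image
    (Finset.univ.filter fun f : Fin n → Fin k => Adm G c γ p k f) (fun f => crossI G f)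
    ⟨f0, by simpa using hf0⟩
  refine ⟨k, hk1, f, by simpa using hf, fun g hg => hmin g (by simpa using hg), ?_⟩
  intro g hg
  exact hmax ⟨g, hg⟩

/-- **Partitioning Lemma.** -/
theorem stmt5 (c α ξ : ℝ) (hc : c ∈ Set.Ioo (0 : ℝ) 1) (hα : α ∈ Set.Ioo (0 : ℝ) 1)
    (hξ : ξ ∈ Set.Ioo (0 : ℝ) 1) :
    ∃ γ η : ℝ, 0 < γ ∧ 0 < η ∧ ∃ n₀ : ℕ, ∀ n : ℕ, n₀ ≤ n →
      ∀ p β : ℝ, 0 < p → p < 1 → β ≤ η * (n : ℝ) * p →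
        ∀ G : SimpleGraph (Fin n), IsSparse G p β →
          (∀ v, (c + α) * (n : ℝ) * p ≤ (degIn G v Finset.univ : ℝ)) →
          ∃ ℓ : ℕ, 1 ≤ ℓ ∧ (ℓ : ℝ) < 1 / c ∧
            ∃ P : Fin ℓ → Finset (Fin n),
              (∀ i j, i ≠ j → Disjoint (P i) (P j)) ∧
              (Finset.univ.biUnion P = Finset.univ) ∧
              ∀ i,
                IsExpanderOn G (γ * p) (P i) ∧
                (∀ v ∈ P i, c ^ 2 * (n : ℝ) * p ≤ (degIn G v (P i) : ℝ)) ∧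
                ((((P i).filter fun v =>
                    (degIn G v (P i) : ℝ) < (c + α - ξ) * (n : ℝ) * p).card : ℝ)
                  ≤ ξ * ((P i).card : ℝ)) := by
  obtain ⟨hc0, hc1⟩ := hc
  obtain ⟨hα0, hα1⟩ := hα
  obtain ⟨hξ0, hξ1⟩ := hξ
  obtain ⟨ε, hε0, hε1, hε2⟩ : ∃ ε : ℝ, 0 < ε ∧ ε ≤ c ^ 2 * (α / 8) ∧ ε ≤ ξ ^ 2 * c :=
    ⟨min (c ^ 2 * (α / 8)) (ξ ^ 2 * c), lt_min (by positivity) (by positivity),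
      min_le_left _ _, min_le_right _ _⟩
  obtain ⟨γ, hγdef⟩ : ∃ γ : ℝ, γ = c * ε / 2 := ⟨_, rfl⟩
  have hγ0 : 0 < γ := by rw [hγdef]; positivity
  have hcα : c * α ≤ α := by nlinarith
  have hγ1 : γ ≤ c * α / 8 := by
    have h1 : c * ε ≤ 1 * ε := by gcongr
    have h2 : c ^ 2 * (α / 8) ≤ c * (α / 8) := by
      have : c ^ 2 ≤ c := by nlinarith
      gcongr
    rw [hγdef]; linarith
  refine ⟨γ, c * α / 8, hγ0, by positivity, ⌈2 / α⌉₊ + 1, ?_⟩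
  intro n hn p β hp0 hp1 hβ G hG hdeg
  have hn0 : 0 < n := by omega
  have hn' : (0 : ℝ) < n := by exact_mod_cast hn0
  have hnα : 1 ≤ α / 2 * n := by
    have h1 : 2 / α ≤ n := (Nat.le_ceil _).trans (by exact_mod_cast (by omega : ⌈2 / α⌉₊ ≤ n))
    rw [div_le_iff₀ hα0] at h1; linarith
  obtain ⟨k, hk1, f, hf, hmin, hmax⟩ := exists_opt G c γ p hn0 hc0 hc1 hγ0 hp0
  have hkc := adm_bound f c hn0 hf.1
  have hcr : crossI G f ≤ ε * p * n ^ 2 := by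
    refine hf.2.trans ?_
    have : 2 * γ * k * p * n ^ 2 = (k * c) * (ε * p * n ^ 2) := by rw [hγdef]; ring
    rw [this]
    calc (k * c) * (ε * p * n ^ 2) ≤ 1 * (ε * p * n ^ 2) := by gcongr
      _ = _ := one_mul _
  have boost : ∀ i, ∀ Y ⊆ cls f i, c ^ 2 * n ≤ (Y.card : ℝ) →
      (eBtw G Y (cls f i \ Y) : ℝ) ≤ γ * p * Y.card * n → (c + α / 2) * n ≤ Y.card :=
    fun i Y hY h1 h2 => size_boost G f i c α p β (c * α / 8) ε γ hc0 hp0 hn0 hε0.le hε1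
      (by linarith) (by linarith) hβ hG hdeg hcr Y hY h1 h2
  have hc2 : c ^ 2 ≤ c := by nlinarith
  have hbig : ∀ i, (c + α / 2) * n ≤ ((cls f i).card : ℝ) := by
    intro i
    refine boost i _ (Finset.Subset.refl _) ?_ ?_
    · exact le_trans (by gcongr) (hf.1 i)
    · have : (eBtw G (cls f i) (cls f i \ cls f i) : ℝ) = 0 := by simp [eBtw_eq]
      rw [this]; positivity
  have hkα := adm_bound f (c + α / 2) hn0 hbig
  have hk0 : (0 : ℝ) < k := by exact_mod_cast hk1
  have hmove : ∀ v j, (degIn G v (cls f j) : ℝ) ≤ degIn G v (cls f (f v)) := by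
    intro v j
    by_contra hcon
    push Not at hcon
    have hu := crossI_update G f v j
    have hlt : crossI G (Function.update f v j) < crossI G f := by linarith
    refine absurd (hmin (Function.update f v j) ⟨fun i => ?_, ?_⟩) (not_le.mpr hlt)
    · have hsub : (cls f i).erase v ⊆ cls (Function.update f v j) i := by
        intro w hw
        have hwv := Finset.ne_of_mem_erase hw
        have hwi := Finset.mem_of_mem_erase hw
        simp only [cls, Finset.mem_filter, Finset.mem_univ, true_and] at hwi ⊢
        rw [Function.update_of_ne hwv, hwi]
      have h1 := Finset.card_le_card hsub
      have h2 := Finset.pred_card_le_card_erase (s := cls f i) (a := v)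
      have h3 : (cls f i).card ≤ (cls (Function.update f v j) i).card + 1 := by omega
      have h4 : ((cls f i).card : ℝ) ≤ (cls (Function.update f v j) i).card + 1 := by
        exact_mod_cast h3
      have h5 := hbig i
      linarith
    · exact hlt.le.trans hf.2
  have hown : ∀ v, c * (c + α) * n * p ≤ (degIn G v (cls f (f v)) : ℝ) := by
    intro v
    have h1 := sum_degIn_cls G f v
    have h2 := Finset.sum_le_card_nsmul (Finset.univ : Finset (Fin k))
      (fun i => (degIn G v (cls f i) : ℝ)) _ (fun i _ => hmove v i)
    rw [nsmul_eq_mul, Finset.card_fin, h1] at h2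
    have h3 := (hdeg v).trans h2
    have h4 : (0 : ℝ) ≤ degIn G v (cls f (f v)) := by positivity
    calc c * (c + α) * n * p = c * ((c + α) * n * p) := by ring
      _ ≤ c * (k * degIn G v (cls f (f v))) := by gcongr
      _ = (k * c) * degIn G v (cls f (f v)) := by ring
      _ ≤ 1 * degIn G v (cls f (f v)) := by gcongr
      _ = _ := one_mul _
  have hside : ∀ i, ∀ Y ⊆ cls f i, 0 < Y.card →
      (eBtw G Y (cls f i \ Y) : ℝ) ≤ γ * p * Y.card * n → c * n ≤ (Y.card : ℝ) := by
    intro i Y hY hYc hl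
    have hy : (0 : ℝ) < Y.card := by exact_mod_cast hYc
    have h1 := eBtw_self_split G Y _ hY
    have h2 : Y.card * (c * (c + α) * n * p) ≤ ∑ v ∈ Y, (degIn G v (cls f i) : ℝ) := by
      rw [← nsmul_eq_mul]
      refine Finset.card_nsmul_le_sum _ _ _ fun v hv => ?_
      have hvi : f v = i := by simpa [cls] using hY hv
      have := hown v
      rwa [hvi] at this
    have h3 := size_of_dense G p β (c * α / 8) (c * (c + α) - γ) hp0 hβ hG Y hYc (by nlinarith)
    have h4 : c ^ 2 * n ≤ (Y.card : ℝ) := by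
      refine le_trans (mul_le_mul_of_nonneg_right ?_ hn'.le) h3
      have : 0 < c * α := by positivity
      nlinarith
    refine le_trans ?_ (boost i Y hY h4 hl)
    gcongr; linarith
  have hcardn : ∀ Y : Finset (Fin n), (Y.card : ℝ) ≤ n := by
    intro Y
    have := Finset.card_le_univ Y
    rw [Fintype.card_fin] at this
    exact_mod_cast this
  refine ⟨k, hk1, ?_, cls f, ?_, ?_, ?_⟩
  · rw [lt_div_iff₀ hc0]
    have : (0 : ℝ) < k * (α / 2) := by positivity
    linarith
  · intro i j hij
    rw [Finset.disjoint_left]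
    intro u hu hu'
    simp only [cls, Finset.mem_filter, Finset.mem_univ, true_and] at hu hu'
    exact hij (hu.symm.trans hu')
  · ext u
    simp [cls]
  intro i
  refine ⟨?_, ?_, ?_⟩
  · intro X hX
    by_contra hcon
    push Not at hcon
    have he0 : (0 : ℝ) ≤ eBtw G X (cls f i \ X) := by positivity
    have hX0 : 0 < X.card := by
      rcases Nat.eq_zero_or_pos X.card with h | h
      · rw [h] at hcon; simp at hcon; linarith
      · exact h
    have hZ0 : 0 < (cls f i \ X).card := by
      rcases Nat.eq_zero_or_pos (cls f i \ X).card with h | h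
      · rw [h] at hcon; simp at hcon; linarith
      · exact h
    have hXn := hcardn X
    have hZn := hcardn (cls f i \ X)
    have s1 : c * n ≤ (X.card : ℝ) := by
      refine hside i X hX hX0 (hcon.le.trans ?_)
      gcongr
    have s2 : c * n ≤ ((cls f i \ X).card : ℝ) := by
      refine hside i _ Finset.sdiff_subset hZ0 ?_
      rw [Finset.sdiff_sdiff_eq_self hX, eBtw_swap]
      refine hcon.le.trans ?_
      calc γ * p * X.card * (cls f i \ X).card ≤ γ * p * n * (cls f i \ X).card := by gcongr
        _ = _ := by ring
    refine hmax (fun u => if u ∈ X then Fin.last k else (f u).castSucc) ⟨?_, ?_⟩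
    · intro j
      refine Fin.lastCases ?_ (fun j => ?_) j
      · refine s1.trans ?_
        gcongr
        intro u hu
        simp [cls, hu]
      · have hsub : cls f j \ X ⊆
            cls (fun u => if u ∈ X then Fin.last k else (f u).castSucc) j.castSucc := by
          intro u hu
          simp only [cls, Finset.mem_sdiff, Finset.mem_filter, Finset.mem_univ, true_and] at hu ⊢
          simp [hu.1, hu.2]
        have hle : ((cls f j \ X).card : ℝ) ≤
            (cls (fun u => if u ∈ X then Fin.last k else (f u).castSucc) j.castSucc).card := by
          exact_mod_cast Finset.card_le_card hsub
        refine le_trans ?_ hle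
        by_cases hji : j = i
        · subst hji; exact s2
        · have : cls f j \ X = cls f j := by
            rw [Finset.sdiff_eq_self_iff_disjoint, Finset.disjoint_left]
            intro u hu hu'
            have hu2 := hX hu'
            simp only [cls, Finset.mem_filter, Finset.mem_univ, true_and] at hu hu2
            exact hji (hu.symm.trans hu2)
          rw [this]; exact hf.1 j
    · refine (crossI_split G f i X hX).trans ?_
      have h1 : (eBtw G X (cls f i \ X) : ℝ) ≤ γ * p * n * n := by
        refine hcon.le.trans ?_
        gcongr
      have h2 := hf.2
      push_cast
      nlinarith
  · intro v hv
    have hvi : f v = i := by simpa [cls] using hv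
    have h := hown v
    rw [hvi] at h
    refine le_trans ?_ h
    gcongr
    nlinarith
  · set B := (cls f i).filter fun v => (degIn G v (cls f i) : ℝ) < (c + α - ξ) * (n : ℝ) * p
      with hB
    have h1 := leave_le G f i B (Finset.filter_subset _ _)
    have h2 : B.card * (ξ * n * p) ≤
        ∑ v ∈ B, ((degIn G v Finset.univ : ℝ) - degIn G v (cls f i)) := by
      rw [← nsmul_eq_mul]
      refine Finset.card_nsmul_le_sum _ _ _ fun v hv => ?_
      have h3 := (Finset.mem_filter.mp hv).2
      have h4 := hdeg v
      nlinarith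
    have h3 : B.card * (ξ * n * p) ≤ (ξ * (c * n)) * (ξ * n * p) := by
      calc _ ≤ ε * p * n ^ 2 := h2.trans (h1.trans hcr)
        _ ≤ (ξ ^ 2 * c) * p * n ^ 2 := by gcongr
        _ = _ := by ring
    have h4 := le_of_mul_le_mul_right h3 (by positivity)
    refine h4.trans ?_
    have := hf.1 i
    gcongr
end

section
/- Let γ ∈ (0, 1), let G be a (p, β)-sparse graph on n vertices (n sufficiently large), and let U, W ⊆ V(G) be disjoint subsets with |W| ≥ 10·γ⁻¹·β·√(log n)/p. Let Z ⊆ W be a subset with |Z| ≤ min{γ·|W|/20, |U|·log n}. If X ⊆ U ∪ W is a set such that |X| ≥ |U| and e_G(X, W \ X) ≥ γ·|X|·|W|·p/2, then |N_G(X, W \ (X ∪ Z))| ≥ min{|X|·log n, γ·|W|/5}. -/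
open Finset
open scoped Classical

/-- `nbhdIn G X Y` is the set of vertices of `Y` having a neighbour in `X`. -/
noncomputable def nbhdIn {V : Type} (G : SimpleGraph V) (X Y : Finset V) : Finset V :=
  Y.filter fun y => ∃ x ∈ X, G.Adj x y

/-- **Expansion claim.** -/
theorem stmt12 (γ : ℝ) (hγ : γ ∈ Set.Ioo (0 : ℝ) 1) :
    ∃ n₀ : ℕ, ∀ n : ℕ, n₀ ≤ n →
      ∀ p β : ℝ, 0 < p → p < 1 → 0 < β →
        ∀ G : SimpleGraph (Fin n), IsSparse G p β →
          ∀ U W : Finset (Fin n), Disjoint U W →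
            10 * γ⁻¹ * β * Real.sqrt (Real.log n) / p ≤ (W.card : ℝ) →
            ∀ Z ⊆ W,
              (Z.card : ℝ) ≤ min (γ * (W.card : ℝ) / 20) ((U.card : ℝ) * Real.log n) →
              ∀ X ⊆ U ∪ W, U.card ≤ X.card →
                γ * (X.card : ℝ) * (W.card : ℝ) * p / 2 ≤ (eBtw G X (W \ X) : ℝ) →
                min ((X.card : ℝ) * Real.log n) (γ * (W.card : ℝ) / 5) ≤
                  ((nbhdIn G X (W \ (X ∪ Z))).card : ℝ) := by
  obtain ⟨hγ0, hγ1⟩ := hγ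
  refine ⟨0, ?_⟩
  intro n _ p β hp _ hβ G hG U W _ hW Z hZ hZc X hX hUX he
  by_contra hcon
  push Not at hcon
  obtain ⟨h1, h2⟩ := lt_min_iff.1 hcon
  obtain ⟨hz1, hz2⟩ := le_min_iff.1 hZc
  set N := nbhdIn G X (W \ (X ∪ Z)) with hN
  have hL : 0 ≤ Real.log n := Real.log_natCast_nonneg n
  have hsub : eBtw G X (W \ X) ≤ eBtw G X (N ∪ Z) := by
    unfold eBtw
    apply Finset.card_le_card
    rintro ⟨a, b⟩ hab
    simp only [Finset.mem_filter, Finset.mem_product, Finset.mem_sdiff, Finset.mem_union, hN,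
      nbhdIn] at hab ⊢
    obtain ⟨⟨ha, hbW, hbX⟩, hadj⟩ := hab
    refine ⟨⟨ha, ?_⟩, hadj⟩
    by_cases hbZ : b ∈ Z
    · exact Or.inr hbZ
    · exact Or.inl ⟨⟨hbW, fun h => h.elim hbX hbZ⟩, a, ha, hadj⟩
  have hsubR : (eBtw G X (W \ X) : ℝ) ≤ eBtw G X (N ∪ Z) := by exact_mod_cast hsub
  have hsp := hG X (N ∪ Z)
  have hcard : ((N ∪ Z).card : ℝ) ≤ N.card + Z.card := by
    exact_mod_cast Finset.card_union_le N Z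
  have hUXR : (U.card : ℝ) ≤ X.card := by exact_mod_cast hUX
  have hm0 : (0 : ℝ) ≤ N.card := Nat.cast_nonneg _
  have hx : (0 : ℝ) < X.card := by
    by_contra h
    have : (X.card : ℝ) * Real.log n ≤ 0 := mul_nonpos_of_nonpos_of_nonneg (not_lt.1 h) hL
    linarith
  have hw : (0 : ℝ) < W.card := by
    have : 0 < γ * (W.card : ℝ) := by linarith
    exact pos_of_mul_pos_right this hγ0.le
  generalize (X.card : ℝ) = x at *
  generalize (W.card : ℝ) = w at *
  generalize ((N ∪ Z).card : ℝ) = k at *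
  have hk1 : k ≤ γ * w / 4 := by linarith
  have hk2 : k ≤ 2 * (x * Real.log n) := by
    have := mul_le_mul_of_nonneg_right hUXR hL
    linarith
  have hs : Real.sqrt (x * k) ≤ 3 / 2 * x * Real.sqrt (Real.log n) := by
    apply Real.sqrt_le_iff.2
    refine ⟨by positivity, ?_⟩
    rw [mul_pow, Real.sq_sqrt hL]
    have := mul_le_mul_of_nonneg_left hk2 hx.le
    nlinarith [mul_nonneg (mul_nonneg hx.le hx.le) hL]
  have hb : 10 * (β * Real.sqrt (Real.log n)) ≤ γ * w * p := by
    rw [div_le_iff₀ hp] at hW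
    have := mul_le_mul_of_nonneg_left hW hγ0.le
    have e : γ * (10 * γ⁻¹ * β * Real.sqrt (Real.log n)) = 10 * (β * Real.sqrt (Real.log n)) := by
      field_simp
    linarith
  have hA := mul_le_mul_of_nonneg_left hk1 (mul_pos hp hx).le
  have hB := mul_le_mul_of_nonneg_left hs hβ.le
  have hC := mul_le_mul_of_nonneg_left hb hx.le
  have hD : 0 < x * (γ * w * p) := by positivity
  nlinarith
end

section
/- For all c, α ∈ (0, 1), there exist positive γ = γ(α, c) and η = η(α, c) such that the following holds for all sufficiently large n. Let p ∈ (0, 1) and β ≤ η·n·p, and let G be a (p, β)-sparse graph with n vertices and minimum degree at least (c + α)·n·p. Then for some integer 1 ≤ ℓ < 1/c, there exists a (c, α, γ)-perfect partition V(G) = V₀ ∪ V₁ ∪ ⋯ ∪ V_ℓ of the vertex set of G. -/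
open Finset
open scoped Classical

lemma eBtw_eq_sum {V : Type} [DecidableEq V] (G : SimpleGraph V) (X Y : Finset V) :
    eBtw G X Y = ∑ x ∈ X, degIn G x Y := by
  unfold eBtw degIn
  rw [Finset.card_filter, Finset.sum_product]
  refine Finset.sum_congr rfl fun x _ => ?_
  rw [Finset.card_filter]

lemma degIn_union {V : Type} [DecidableEq V] (G : SimpleGraph V) (v : V) {A B : Finset V} (h : Disjoint A B) :
    degIn G v (A ∪ B) = degIn G v A + degIn G v B := by
  unfold degIn
  rw [Finset.filter_union, Finset.card_union_of_disjoint (Finset.disjoint_filter_filter h)]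

lemma eBtw_union_left {V : Type} [DecidableEq V] (G : SimpleGraph V) {A B : Finset V} (C : Finset V)
    (h : Disjoint A B) : eBtw G (A ∪ B) C = eBtw G A C + eBtw G B C := by
  simp only [eBtw_eq_sum]
  rw [Finset.sum_union h]

lemma eBtw_union_right {V : Type} [DecidableEq V] (G : SimpleGraph V) {A B : Finset V} (C : Finset V)
    (h : Disjoint A B) : eBtw G C (A ∪ B) = eBtw G C A + eBtw G C B := by
  simp only [eBtw_eq_sum]
  rw [← Finset.sum_add_distrib]
  exact Finset.sum_congr rfl fun x _ => degIn_union G x h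

lemma eBtw_comm' {V : Type} [DecidableEq V] (G : SimpleGraph V) (X Y : Finset V) :
    eBtw G X Y = eBtw G Y X := by
  unfold eBtw
  refine Finset.card_bij (fun e _ => (e.2, e.1)) ?_ ?_ ?_
  · intro e he
    simp only [Finset.mem_filter, Finset.mem_product] at he ⊢
    exact ⟨⟨he.1.2, he.1.1⟩, he.2.symm⟩
  · rintro ⟨a, b⟩ _ ⟨c, d⟩ _ h
    simp only [Prod.mk.injEq] at h ⊢
    exact ⟨h.2, h.1⟩
  · rintro ⟨a, b⟩ he
    simp only [Finset.mem_filter, Finset.mem_product] at he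
    refine ⟨(b, a), ?_, rfl⟩
    simp only [Finset.mem_filter, Finset.mem_product]
    exact ⟨⟨he.1.2, he.1.1⟩, he.2.symm⟩

lemma eBtw_erase {V : Type} [DecidableEq V] (G : SimpleGraph V) (S : Finset V) (v : V) (hv : v ∈ S) :
    eBtw G S S = eBtw G (S.erase v) (S.erase v) + 2 * degIn G v S := by
  have hd : Disjoint {v} (S.erase v) := by simp
  have hS : S = {v} ∪ S.erase v := by
    rw [← Finset.insert_eq, Finset.insert_erase hv]
  have h1 : ∀ T, eBtw G {v} T = degIn G v T := fun T => by rw [eBtw_eq_sum, Finset.sum_singleton]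
  have h2 : degIn G v {v} = 0 := by
    unfold degIn
    simp [Finset.filter_singleton]
  have h3 : degIn G v S = degIn G v (S.erase v) := by
    conv_lhs => rw [hS]
    rw [degIn_union G v hd, h2, zero_add]
  have h4 : eBtw G S S = eBtw G ({v} ∪ S.erase v) ({v} ∪ S.erase v) := by rw [← hS]
  rw [h4, eBtw_union_left G _ hd, eBtw_union_right G _ hd, eBtw_union_right G _ hd,
    eBtw_comm' G (S.erase v) {v}, h1, h1, h2, h3]
  ring

lemma card_mul_le_eBtw {V : Type} [DecidableEq V] (G : SimpleGraph V) (X Y : Finset V) (D : ℝ)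
    (h : ∀ v ∈ X, D ≤ (degIn G v Y : ℝ)) : (X.card : ℝ) * D ≤ (eBtw G X Y : ℝ) := by
  rw [eBtw_eq_sum]
  push_cast
  have := Finset.card_nsmul_le_sum X (fun v => (degIn G v Y : ℝ)) D h
  simpa [nsmul_eq_mul] using this

/-- Cleaning lemma. -/
lemma clean {V : Type} [DecidableEq V] (G : SimpleGraph V) (N p d₀ δ γ η : ℝ) (hp : 0 < p)
    (hδ : 0 < δ) (hη : η ≤ δ / 2) (hγ : γ ≤ δ ^ 2 / 8) (hN : 4 ≤ δ * N)
    (hsp : ∀ Z : Finset V, (eBtw G Z Z : ℝ) ≤ p * (Z.card : ℝ) ^ 2 + η * N * p * (Z.card : ℝ))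
    (X Y : Finset V) (hXY : Disjoint X Y)
    (hdeg : ∀ v ∈ X, (d₀ + δ) * N * p ≤ (degIn G v (X ∪ Y) : ℝ))
    (he : (eBtw G X Y : ℝ) ≤ γ * p * N ^ 2) :
    ∃ S ⊆ X, δ * ((X.card : ℝ) - S.card) ≤ 2 * γ * N ∧
      ∀ v ∈ S, d₀ * N * p ≤ (degIn G v S : ℝ) := by
  have hNpos : 0 < N := by
    by_contra h
    nlinarith
  set g : Finset V → ℝ := fun S => (eBtw G S S : ℝ) - 2 * (d₀ * N * p) * S.card with hg
  set F : Finset (Finset V) :=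
    X.powerset.filter (fun S => (X.card : ℝ) - S.card ≤ δ / 2 * N) with hF
  have hXF : X ∈ F := by
    rw [hF, Finset.mem_filter]
    refine ⟨by simp, ?_⟩
    rw [sub_self]; positivity
  obtain ⟨S, hSF, hmax⟩ := Finset.exists_max_image F g ⟨X, hXF⟩
  have hS := hSF
  rw [hF, Finset.mem_filter, Finset.mem_powerset] at hS
  obtain ⟨hSX, hSc⟩ := hS
  have hdisj : Disjoint S (X \ S) := Finset.disjoint_sdiff
  have hun : S ∪ (X \ S) = X := Finset.union_sdiff_of_subset hSX
  set Z := X \ S with hZ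
  have hcard : (X.card : ℝ) = S.card + Z.card := by
    rw [← hun, Finset.card_union_of_disjoint hdisj]; push_cast; ring
  have hgX := hmax X hXF
  simp only [hg] at hgX
  have eX : (eBtw G X X : ℝ) = eBtw G S S + 2 * eBtw G Z S + eBtw G Z Z := by
    rw [← hun, eBtw_union_left G _ hdisj, eBtw_union_right G _ hdisj, eBtw_union_right G _ hdisj,
      eBtw_comm' G S Z]
    push_cast; ring
  have hZdeg := card_mul_le_eBtw G Z (X ∪ Y) _
    (fun v hv => hdeg v (Finset.sdiff_subset hv))
  have e2 : (eBtw G Z (X ∪ Y) : ℝ) = eBtw G Z S + eBtw G Z Z + eBtw G Z Y := by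
    rw [eBtw_union_right G _ hXY]
    conv_lhs => rw [← hun]
    rw [eBtw_union_right G _ hdisj]
    push_cast; ring
  have e3 : (eBtw G Z Y : ℝ) ≤ eBtw G X Y := by
    rw [← hun, eBtw_union_left G _ hdisj]
    push_cast
    have : (0 : ℝ) ≤ eBtw G S Y := Nat.cast_nonneg _
    linarith
  have e4 := hsp Z
  have hz0 : (0 : ℝ) ≤ Z.card := Nat.cast_nonneg _
  set z : ℝ := (Z.card : ℝ) with hz
  have hzτ : z ≤ δ / 2 * N := by linarith
  rw [hcard] at hgX
  have key : p * (2 * δ * N * z) ≤ p * (z ^ 2 + η * N * z + 2 * γ * N ^ 2) := by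
    nlinarith
  have key2 := le_of_mul_le_mul_left key hp
  have k3 : z ^ 2 ≤ δ / 2 * N * z := by nlinarith
  have k4 : η * N * z ≤ δ / 2 * N * z := by
    have : 0 ≤ N * z := by positivity
    nlinarith
  have k5 : N * (δ * z) ≤ N * (2 * γ * N) := by nlinarith
  have k6 := le_of_mul_le_mul_left k5 hNpos
  refine ⟨S, hSX, by rw [hcard]; linarith, ?_⟩
  intro v hv
  have k7 : z ≤ δ / 4 * N := by
    have : δ * z ≤ δ * (δ / 4 * N) := by nlinarith
    exact le_of_mul_le_mul_left this hδ
  have hce : ((S.erase v).card : ℝ) = S.card - 1 := by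
    rw [Finset.card_erase_of_mem hv, Nat.cast_sub (Finset.card_pos.mpr ⟨v, hv⟩)]; simp
  have hmem : S.erase v ∈ F := by
    rw [hF, Finset.mem_filter, Finset.mem_powerset]
    refine ⟨(Finset.erase_subset _ _).trans hSX, ?_⟩
    rw [hce, hcard]
    linarith
  have := hmax _ hmem
  simp only [hg] at this
  rw [hce, eBtw_erase G S v hv] at this
  push_cast at this
  linarith

/-- lower bound on sizes -/
lemma size_lower {V : Type} [DecidableEq V] (G : SimpleGraph V) (N p D η : ℝ) (hp : 0 < p)
    (hsp : ∀ Z : Finset V, (eBtw G Z Z : ℝ) ≤ p * (Z.card : ℝ) ^ 2 + η * N * p * (Z.card : ℝ))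
    (X : Finset V) (hX : X.Nonempty)
    (h : (X.card : ℝ) * (D * N * p) ≤ eBtw G X X) : (D - η) * N ≤ X.card := by
  have h1 := hsp X
  have hx : (0 : ℝ) < X.card := by exact_mod_cast hX.card_pos
  have : (p * X.card) * ((D - η) * N) ≤ (p * X.card) * X.card := by nlinarith
  exact le_of_mul_le_mul_left this (by positivity)

/-- Splitting lemma. -/
lemma split {n : ℕ} (G : SimpleGraph (Fin n)) (p c d₀ δ γ η : ℝ) (hp : 0 < p)
    (hδ : 0 < δ) (hη : η ≤ δ / 2) (hγ : γ ≤ δ ^ 2 / 8) (hγ2 : γ ≤ δ / 4)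
    (hγ3 : γ ≤ δ * c / 4) (hc : 0 < c) (hγ0 : 0 < γ) (hcd : c ≤ d₀)
    (hN : 4 ≤ δ * n)
    (hsp : ∀ Z : Finset (Fin n),
      (eBtw G Z Z : ℝ) ≤ p * (Z.card : ℝ) ^ 2 + η * n * p * (Z.card : ℝ))
    (S : Finset (Fin n))
    (hdeg : ∀ v ∈ S, (d₀ + δ) * n * p ≤ (degIn G v S : ℝ))
    (hne : ¬ IsExpanderOn G (γ * p) S) :
    ∃ A B : Finset (Fin n), A ⊆ S ∧ B ⊆ S ∧ Disjoint A B ∧ A.Nonempty ∧ B.Nonempty ∧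
      δ * ((S.card : ℝ) - A.card - B.card) ≤ 4 * γ * n ∧
      (∀ v ∈ A, d₀ * n * p ≤ (degIn G v A : ℝ)) ∧
      (∀ v ∈ B, d₀ * n * p ≤ (degIn G v B : ℝ)) := by
  have hn : (0 : ℝ) < n := by
    by_contra h
    nlinarith
  unfold IsExpanderOn at hne
  push Not at hne
  obtain ⟨X, hXS, hlt⟩ := hne
  have main : ∀ X Y : Finset (Fin n), Disjoint X Y → X ∪ Y = S →
      (eBtw G X Y : ℝ) < γ * p * X.card * Y.card →
      ∃ A ⊆ X, δ * ((X.card : ℝ) - A.card) ≤ 2 * γ * n ∧ A.Nonempty ∧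
      ∀ v ∈ A, d₀ * n * p ≤ (degIn G v A : ℝ) := by
    intro X Y hXY hU hlt
    have hXn : (X.card : ℝ) ≤ n := by
      exact_mod_cast (Finset.card_le_univ X).trans (by simp)
    have hYn : (Y.card : ℝ) ≤ n := by
      exact_mod_cast (Finset.card_le_univ Y).trans (by simp)
    have hX0 : (0 : ℝ) ≤ X.card := Nat.cast_nonneg _
    have hY0 : (0 : ℝ) ≤ Y.card := Nat.cast_nonneg _
    have he0 : (0 : ℝ) ≤ eBtw G X Y := Nat.cast_nonneg _
    have hXne : X.Nonempty := by
      by_contra h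
      rw [Finset.not_nonempty_iff_eq_empty] at h
      subst h
      simp at hlt
      linarith
    have hgp : 0 < γ * p := by positivity
    have he1 : (eBtw G X Y : ℝ) ≤ γ * p * X.card * n :=
      hlt.le.trans (mul_le_mul_of_nonneg_left hYn (by positivity))
    have he2 : (eBtw G X Y : ℝ) ≤ γ * p * (n : ℝ) ^ 2 := by
      refine he1.trans ?_
      have : γ * p * X.card * n ≤ γ * p * n * n := by gcongr
      linarith
    have hdegX : ∀ v ∈ X, (d₀ + δ) * n * p ≤ (degIn G v (X ∪ Y) : ℝ) := by
      intro v hv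
      rw [hU]
      exact hdeg v (hU ▸ Finset.mem_union_left _ hv)
    obtain ⟨A, hAX, hA1, hA2⟩ := clean G n p d₀ δ γ η hp hδ hη hγ hN hsp X Y hXY hdegX he2
    have hs := card_mul_le_eBtw G X (X ∪ Y) _ hdegX
    rw [eBtw_union_right G _ hXY] at hs
    push_cast at hs
    have hs2 := size_lower G n p (d₀ + δ - γ) η hp hsp X hXne (by nlinarith)
    have hs3 : c * n < X.card := by
      have : c * n < (d₀ + δ - γ - η) * n := by
        apply mul_lt_mul_of_pos_right _ hn
        linarith
      linarith
    refine ⟨A, hAX, hA1, ?_, hA2⟩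
    by_contra h
    rw [Finset.not_nonempty_iff_eq_empty] at h
    subst h
    simp at hA1
    have h5 : γ * n ≤ δ * c / 4 * n := by gcongr
    have h6 : δ * (c * n) < δ * X.card := by gcongr
    have : 0 < δ * c * n := by positivity
    nlinarith
  have hd : Disjoint X (S \ X) := Finset.disjoint_sdiff
  have hU : X ∪ (S \ X) = S := Finset.union_sdiff_of_subset hXS
  obtain ⟨A, hAX, hA1, hA2, hA3⟩ := main X (S \ X) hd hU hlt
  obtain ⟨B, hBX, hB1, hB2, hB3⟩ := main (S \ X) X hd.symm (by rw [Finset.union_comm, hU])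
    (by rw [eBtw_comm']; linarith)
  refine ⟨A, B, hAX.trans hXS, hBX.trans Finset.sdiff_subset, ?_, hA2, hB2, ?_, hA3, hB3⟩
  · exact Finset.disjoint_of_subset_left hAX (Finset.disjoint_of_subset_right hBX hd)
  · have : (S.card : ℝ) = X.card + (S \ X).card := by
      conv_lhs => rw [← hU]
      rw [Finset.card_union_of_disjoint hd]; push_cast; ring
    rw [this]
    nlinarith

/-- Good families of parts. -/
structure GoodFam {n : ℕ} (G : SimpleGraph (Fin n)) (p c α ε : ℝ)
    (Q : Finset (Finset (Fin n))) : Prop where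
  disj : ∀ A ∈ Q, ∀ B ∈ Q, A ≠ B → Disjoint A B
  nonempty : ∀ A ∈ Q, A.Nonempty
  deg : ∀ A ∈ Q, ∀ v ∈ A, (c + α / 2 ^ Q.card) * (n : ℝ) * p ≤ (degIn G v A : ℝ)
  cover : (1 - Q.card * ε) * (n : ℝ) ≤ ∑ A ∈ Q, (A.card : ℝ)
  pos : 1 ≤ Q.card

lemma GoodFam.sum_eq {n : ℕ} {G : SimpleGraph (Fin n)} {p c α ε : ℝ}
    {Q : Finset (Finset (Fin n))} (h : GoodFam G p c α ε Q) :
    ∑ A ∈ Q, (A.card : ℝ) = ((Q.biUnion id).card : ℝ) := by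
  rw [Finset.card_biUnion]
  · simp
  · intro A hA B hB hAB
    exact h.disj A hA B hB hAB

lemma GoodFam.card_lt {n : ℕ} {G : SimpleGraph (Fin n)} {p c α ε δ η : ℝ} {M : ℕ}
    {Q : Finset (Finset (Fin n))} (h : GoodFam G p c α ε Q) (hn : (0 : ℝ) < n) (hp : 0 < p)
    (hα : 0 < α) (hδ : δ = α / 2 ^ M) (hη : η ≤ δ / 2) (hQ : Q.card ≤ M)
    (hsp : ∀ Z : Finset (Fin n),
      (eBtw G Z Z : ℝ) ≤ p * (Z.card : ℝ) ^ 2 + η * n * p * (Z.card : ℝ)) (hc : 0 < c) :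
    (Q.card : ℝ) < 1 / c := by
  have hδ0 : 0 < δ := by rw [hδ]; positivity
  have hle : δ ≤ α / 2 ^ Q.card := by
    rw [hδ]
    gcongr
    norm_num
  have hs : ∀ A ∈ Q, c * n < (A.card : ℝ) := by
    intro A hA
    have h1 := card_mul_le_eBtw G A A _ (h.deg A hA)
    have h2 := size_lower G n p _ η hp hsp A (h.nonempty A hA) h1
    refine lt_of_lt_of_le ?_ h2
    apply mul_lt_mul_of_pos_right _ hn
    linarith
  have hQne : Q.Nonempty := Finset.card_pos.mp h.pos
  have h3 : ∑ A ∈ Q, c * (n : ℝ) < ∑ A ∈ Q, (A.card : ℝ) :=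
    Finset.sum_lt_sum_of_nonempty hQne hs
  rw [h.sum_eq, Finset.sum_const, nsmul_eq_mul] at h3
  have h4 : ((Q.biUnion id).card : ℝ) ≤ n := by
    exact_mod_cast (Finset.card_le_univ _).trans (by simp)
  rw [lt_div_iff₀ hc]
  have : (Q.card * c) * (n : ℝ) < 1 * n := by linarith
  exact lt_of_mul_lt_mul_right this hn.le

lemma GoodFam.step {n : ℕ} {G : SimpleGraph (Fin n)} {p c α ε : ℝ}
    {Q : Finset (Finset (Fin n))} (h : GoodFam G p c α ε Q) (S A B : Finset (Fin n))
    (hS : S ∈ Q) (hA : A ⊆ S) (hB : B ⊆ S) (hAB : Disjoint A B) (hAn : A.Nonempty)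
    (hBn : B.Nonempty) (hp : 0 < p) (hα : 0 < α)
    (hcard : (S.card : ℝ) - A.card - B.card ≤ ε * n)
    (hAd : ∀ v ∈ A, (c + α / 2 ^ (Q.card + 1)) * (n : ℝ) * p ≤ (degIn G v A : ℝ))
    (hBd : ∀ v ∈ B, (c + α / 2 ^ (Q.card + 1)) * (n : ℝ) * p ≤ (degIn G v B : ℝ)) :
    ∃ Q', GoodFam G p c α ε Q' ∧ Q'.card = Q.card + 1 := by
  have hoff : ∀ T ∈ Q.erase S, Disjoint S T := by
    intro T hT
    rw [Finset.mem_erase] at hT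
    exact h.disj S hS T hT.2 (Ne.symm hT.1)
  have key : ∀ A : Finset (Fin n), A ⊆ S → A.Nonempty → A ∉ Q.erase S := by
    intro A hA hAn hmem
    have := Finset.disjoint_of_subset_left hA (hoff A hmem)
    rw [disjoint_self] at this
    exact hAn.ne_empty this
  have hBnot := key B hB hBn
  have hAnot : A ∉ insert B (Q.erase S) := by
    rw [Finset.mem_insert]
    rintro (rfl | h')
    · rw [disjoint_self] at hAB
      exact hAn.ne_empty hAB
    · exact key A hA hAn h'
  have hc1 : (insert A (insert B (Q.erase S))).card = Q.card + 1 := by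
    rw [Finset.card_insert_of_notMem hAnot, Finset.card_insert_of_notMem hBnot,
      Finset.card_erase_of_mem hS]
    have := h.pos
    omega
  refine ⟨insert A (insert B (Q.erase S)), ⟨?_, ?_, ?_, ?_, by omega⟩, hc1⟩
  · have hA' : ∀ T ∈ Q.erase S, Disjoint A T := fun T hT =>
      Finset.disjoint_of_subset_left hA (hoff T hT)
    have hB' : ∀ T ∈ Q.erase S, Disjoint B T := fun T hT =>
      Finset.disjoint_of_subset_left hB (hoff T hT)
    intro C hC D hD hCD
    rw [Finset.mem_insert, Finset.mem_insert] at hC hD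
    rcases hC with rfl | rfl | hC <;> rcases hD with rfl | rfl | hD
    · exact absurd rfl hCD
    · exact hAB
    · exact hA' _ hD
    · exact hAB.symm
    · exact absurd rfl hCD
    · exact hB' _ hD
    · exact (hA' _ hC).symm
    · exact (hB' _ hC).symm
    · exact h.disj C (Finset.mem_of_mem_erase hC) D (Finset.mem_of_mem_erase hD) hCD
  · intro C hC
    rw [Finset.mem_insert, Finset.mem_insert] at hC
    rcases hC with rfl | rfl | hC
    · exact hAn
    · exact hBn
    · exact h.nonempty C (Finset.mem_of_mem_erase hC)
  · rw [hc1]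
    intro C hC
    rw [Finset.mem_insert, Finset.mem_insert] at hC
    rcases hC with rfl | rfl | hC
    · exact hAd
    · exact hBd
    · intro v hv
      refine le_trans ?_ (h.deg C (Finset.mem_of_mem_erase hC) v hv)
      gcongr
      · norm_num
      · omega
  · rw [hc1, Finset.sum_insert hAnot, Finset.sum_insert hBnot]
    have h1 := Finset.add_sum_erase Q (fun A => (A.card : ℝ)) hS
    have h2 := h.cover
    push_cast
    nlinarith

/-- **Perfect partition lemma.** The `(c, α, γ)`-perfect partition `V = V₀ ∪ V₁ ∪ ⋯ ∪ V_ℓ` is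
given by an exceptional set `V₀` with `|V₀| ≤ αn` and parts `P i` with
`δ(G[P i]) ≥ (c + α/2^ℓ) n p` inducing `γp`-expanders. -/
theorem stmt14 (c α : ℝ) (hc : c ∈ Set.Ioo (0 : ℝ) 1) (hα : α ∈ Set.Ioo (0 : ℝ) 1) :
    ∃ γ η : ℝ, 0 < γ ∧ 0 < η ∧ ∃ n₀ : ℕ, ∀ n : ℕ, n₀ ≤ n →
      ∀ p β : ℝ, 0 < p → p < 1 → β ≤ η * (n : ℝ) * p →
        ∀ G : SimpleGraph (Fin n), IsSparse G p β →
          (∀ v, (c + α) * (n : ℝ) * p ≤ (degIn G v Finset.univ : ℝ)) →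
          ∃ ℓ : ℕ, 1 ≤ ℓ ∧ (ℓ : ℝ) < 1 / c ∧
            ∃ (V₀ : Finset (Fin n)) (P : Fin ℓ → Finset (Fin n)),
              (∀ i j, i ≠ j → Disjoint (P i) (P j)) ∧
              (∀ i, Disjoint V₀ (P i)) ∧
              (V₀ ∪ Finset.univ.biUnion P = Finset.univ) ∧
              ((V₀.card : ℝ) ≤ α * (n : ℝ)) ∧
              (∀ i, ∀ v ∈ P i, (c + α / 2 ^ ℓ) * (n : ℝ) * p ≤ (degIn G v (P i) : ℝ)) ∧
              (∀ i, IsExpanderOn G (γ * p) (P i)) := by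
  obtain ⟨hc0, hc1⟩ := hc
  obtain ⟨hα0, hα1⟩ := hα
  obtain ⟨M, hM⟩ := exists_nat_ge (1 / c + 1)
  have hcinv : 0 < 1 / c := by positivity
  have hM1 : (1 : ℝ) ≤ M := by linarith
  obtain ⟨δ, hδ⟩ : ∃ δ : ℝ, δ = α / 2 ^ M := ⟨_, rfl⟩
  have hδ0 : 0 < δ := by rw [hδ]; positivity
  have hδα : δ ≤ α := by
    rw [hδ]
    exact div_le_self hα0.le (one_le_pow₀ (by norm_num))
  obtain ⟨ε, hε⟩ : ∃ ε : ℝ, ε = α / M := ⟨_, rfl⟩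
  have hε0 : 0 < ε := by rw [hε]; positivity
  have hεM : M * ε = α := by rw [hε]; field_simp
  obtain ⟨γ, hγ0, hγ1, hγ2, hγ3, hγ4⟩ : ∃ γ : ℝ, 0 < γ ∧ γ ≤ δ ^ 2 / 8 ∧ γ ≤ δ / 4 ∧
      γ ≤ δ * c / 4 ∧ γ ≤ δ * ε / 4 := by
    refine ⟨min (min (δ ^ 2 / 8) (δ / 4)) (min (δ * c / 4) (δ * ε / 4)), by positivity,
      ?_, ?_, ?_, ?_⟩
    · exact (min_le_left _ _).trans (min_le_left _ _)
    · exact (min_le_left _ _).trans (min_le_right _ _)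
    · exact (min_le_right _ _).trans (min_le_left _ _)
    · exact (min_le_right _ _).trans (min_le_right _ _)
  obtain ⟨n₀, hn₀⟩ := exists_nat_ge (4 / δ)
  refine ⟨γ, δ / 2, hγ0, by positivity, n₀, ?_⟩
  intro n hn p β hp hp1 hβ G hG hmin
  have hnn : (n₀ : ℝ) ≤ n := by exact_mod_cast hn
  have hN : 4 ≤ δ * n := by
    have := hn₀.trans hnn
    rw [div_le_iff₀ hδ0] at this
    linarith
  have hnpos : (0 : ℝ) < n := by
    by_contra h
    nlinarith
  have hsp : ∀ Z : Finset (Fin n),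
      (eBtw G Z Z : ℝ) ≤ p * (Z.card : ℝ) ^ 2 + δ / 2 * n * p * (Z.card : ℝ) := by
    intro Z
    have h1 := hG Z Z
    rw [Real.sqrt_mul_self (Nat.cast_nonneg _)] at h1
    have h2 : β * (Z.card : ℝ) ≤ δ / 2 * n * p * (Z.card : ℝ) :=
      mul_le_mul_of_nonneg_right hβ (Nat.cast_nonneg _)
    linarith
  have hlt : ∀ Q, GoodFam G p c α ε Q → Q.card ≤ M → (Q.card : ℝ) < 1 / c := fun Q hQ hQM =>
    hQ.card_lt hnpos hp hα0 hδ le_rfl hQM hsp hc0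
  have hinit : GoodFam G p c α ε {Finset.univ} := by
    refine ⟨?_, ?_, ?_, ?_, ?_⟩
    · intro A hA B hB hAB
      rw [Finset.mem_singleton] at hA hB
      exact absurd (hA.trans hB.symm) hAB
    · intro A hA
      rw [Finset.mem_singleton] at hA
      subst hA
      exact ⟨⟨0, by exact_mod_cast hnpos⟩, Finset.mem_univ _⟩
    · intro A hA v _
      rw [Finset.mem_singleton] at hA
      subst hA
      refine le_trans ?_ (hmin v)
      have : α / 2 ^ ({Finset.univ} : Finset (Finset (Fin n))).card ≤ α :=
        div_le_self hα0.le (one_le_pow₀ (by norm_num))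
      gcongr
    · simp
      nlinarith
    · simp
  obtain ⟨Q, hQ, hQM, hmaxQ⟩ : ∃ Q, GoodFam G p c α ε Q ∧ Q.card ≤ M ∧
      ∀ Q', GoodFam G p c α ε Q' → Q'.card ≤ M → Q'.card ≤ Q.card := by
    have hne : (Finset.univ.filter
        (fun Q : Finset (Finset (Fin n)) => GoodFam G p c α ε Q ∧ Q.card ≤ M)).Nonempty := by
      refine ⟨{Finset.univ}, ?_⟩
      rw [Finset.mem_filter]
      refine ⟨Finset.mem_univ _, hinit, ?_⟩
      rw [Finset.card_singleton]
      exact_mod_cast hM1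
    obtain ⟨Q, hQ, hmx⟩ := Finset.exists_max_image _ (fun Q => Q.card) hne
    rw [Finset.mem_filter] at hQ
    refine ⟨Q, hQ.2.1, hQ.2.2, fun Q' h1 h2 => hmx Q' ?_⟩
    rw [Finset.mem_filter]
    exact ⟨Finset.mem_univ _, h1, h2⟩
  have hQlt := hlt Q hQ hQM
  have hQM1 : Q.card + 1 ≤ M := by
    have : (Q.card : ℝ) + 1 ≤ M := by linarith
    exact_mod_cast this
  have hexp : ∀ S ∈ Q, IsExpanderOn G (γ * p) S := by
    intro S hS
    by_contra hne
    have hδle : δ ≤ α / 2 ^ (Q.card + 1) := by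
      rw [hδ]
      gcongr
      norm_num
    have hhalf : α / 2 ^ (Q.card + 1) + α / 2 ^ (Q.card + 1) = α / 2 ^ Q.card := by
      rw [pow_succ]
      field_simp
      ring
    have hpos' : 0 < α / 2 ^ (Q.card + 1) := by positivity
    obtain ⟨A, B, hA, hB, hAB, hAn, hBn, hcd, hAd, hBd⟩ :=
      split G p c (c + α / 2 ^ (Q.card + 1)) δ γ (δ / 2) hp hδ0 le_rfl hγ1 hγ2 hγ3 hc0 hγ0
        (by linarith) hN hsp S (by
          intro v hv
          refine le_trans ?_ (hQ.deg S hS v hv)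
          have : c + α / 2 ^ (Q.card + 1) + δ ≤ c + α / 2 ^ Q.card := by linarith
          gcongr) hne
    have hcd2 : (S.card : ℝ) - A.card - B.card ≤ ε * n := by
      have : 4 * γ * n ≤ δ * (ε * n) := by nlinarith
      exact le_of_mul_le_mul_left (hcd.trans this) hδ0
    obtain ⟨Q', hQ', hQ'c⟩ := hQ.step S A B hS hA hB hAB hAn hBn hp hα0 hcd2 hAd hBd
    have := hmaxQ Q' hQ' (by omega)
    omega
  refine ⟨Q.card, hQ.pos, hQlt, Finset.univ \ Q.biUnion id,
    fun i => (Q.equivFin.symm i : Finset (Fin n)), ?_, ?_, ?_, ?_, ?_, ?_⟩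
  · intro i j hij
    refine hQ.disj _ (Q.equivFin.symm i).2 _ (Q.equivFin.symm j).2 ?_
    intro h
    exact hij (Q.equivFin.symm.injective (Subtype.ext h))
  · intro i
    refine Finset.disjoint_of_subset_right ?_ Finset.sdiff_disjoint
    exact Finset.subset_biUnion_of_mem id (Q.equivFin.symm i).2
  · ext v
    simp only [Finset.mem_union, Finset.mem_sdiff, Finset.mem_univ, true_and, Finset.mem_biUnion,
      iff_true, id]
    by_cases h : ∃ A ∈ Q, v ∈ A
    · right
      obtain ⟨A, hA, hv⟩ := h
      exact ⟨Q.equivFin ⟨A, hA⟩, by simpa using hv⟩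
    · left
      exact h
  · have h1 := hQ.cover
    rw [hQ.sum_eq] at h1
    have h2 := Finset.card_sdiff_add_card_eq_card (Finset.subset_univ (Q.biUnion id))
    have h3 : ((Finset.univ \ Q.biUnion id).card : ℝ) + ((Q.biUnion id).card : ℝ) = n := by
      rw [Finset.card_univ, Fintype.card_fin] at h2
      exact_mod_cast h2
    have h4 : (Q.card : ℝ) * ε ≤ α := by
      rw [← hεM]
      have : (Q.card : ℝ) ≤ M := by exact_mod_cast hQM
      gcongr
    nlinarith
  · intro i v hv
    exact hQ.deg _ (Q.equivFin.symm i).2 v hv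
  · intro i
    exact hexp _ (Q.equivFin.symm i).2
end
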